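/- Let n = 2m, N = 2^n − 1, and F(x) = x^{d_1} + x^{d_2} on F_{2^n} with d_1, d_2 ∈ {1, …, N−1}, wt_2(d_1) = wt_2(d_2) = 2, and gcd(d_1, d_2, N) > 1. If ℓ(n) > m and #S_F = 2^m, then F is EA-equivalent (affine equivalent) to the function x ↦ x^{1+2^l} + x^{2^l+2^m} for some integer l with 0 < l < m. -/

import Mathlib

open Finset

/-- The Walsh transform `W_{F_a}(ω) = Σ_v (−1)^{Tr(a·F(v)) + Tr(ω·v)}`. -/
noncomputable def walsh {K : Type*} [Field K] [Fintype K] [Algebra (ZMod 2) K]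
    (F : K → K) (a ω : K) : ℤ :=
  ∑ v : K, if Algebra.trace (ZMod 2) K (a * F v) + Algebra.trace (ZMod 2) K (ω * v) = 0
    then 1 else -1

/-- The component `F_a` is bent: all Walsh values are `±2^m`. -/
def IsBent {K : Type*} [Field K] [Fintype K] [Algebra (ZMod 2) K]
    (m : ℕ) (F : K → K) (a : K) : Prop :=
  ∀ ω : K, walsh F a ω = 2 ^ m ∨ walsh F a ω = -(2 ^ m)

/-- `wt₂(j)`: the binary digit sum of the representative of `j mod N` in `{0, …, N−1}`. -/
def wt2 (N : ℕ) (j : ℤ) : ℕ := (Nat.digits 2 (j % (N : ℤ)).toNat).sum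

/-- The `F₂`-span of the Frobenius orbit `{γ, γ², γ⁴, …}` of `γ`. -/
def frobSpan (K : Type*) [Field K] [Algebra (ZMod 2) K] (γ : K) : Submodule (ZMod 2) K :=
  Submodule.span (ZMod 2) (Set.range fun i : ℕ => γ ^ (2 ^ i))

/-- A map `K → K` is affine if it is an `F₂`-linear map plus a constant. -/
def IsAffineMap {K : Type*} [Field K] [Algebra (ZMod 2) K] (A : K → K) : Prop :=
  ∃ (L : K →ₗ[ZMod 2] K) (c : K), ∀ x, A x = L x + c

/-- `F` and `F'` are EA-equivalent: `F' = A' ∘ F ∘ A + L''` for affine bijections `A, A'`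
and an affine map `L''`. -/
def EAEquiv {K : Type*} [Field K] [Algebra (ZMod 2) K] (F F' : K → K) : Prop :=
  ∃ A A' L'' : K → K,
    IsAffineMap A ∧ Function.Bijective A ∧
    IsAffineMap A' ∧ Function.Bijective A' ∧
    IsAffineMap L'' ∧
    ∀ x, F' x = A' (F (A x)) + L'' x

theorem orderOf_dvd_sum_of_invariant {G : Type*} [Group G] [Fintype G] (ζ : G) (f : G → ℤ)
    (hf : ∀ u, f (u * ζ) = f u) : (orderOf ζ : ℤ) ∣ ∑ u, f u := by
  classical
  have hpow : ∀ (k : ℕ) (u : G), f (u * ζ ^ k) = f u := by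
    intro k
    induction k with
    | zero => simp
    | succ k ih => intro u; rw [pow_succ, ← mul_assoc, hf, ih]
  have hH : ∀ (u : G) (h : Subgroup.zpowers ζ), f (u * h) = f u := by
    rintro u ⟨h, hh⟩
    obtain ⟨k, -, rfl⟩ := (mem_zpowers_iff_mem_range_orderOf (x := ζ)).1 hh |> Finset.mem_image.1
    exact hpow k u
  let e := (Subgroup.groupEquivQuotientProdSubgroup (s := Subgroup.zpowers ζ))
  have he : ∀ u, f u = f (e u).1.out := by
    intro u
    have : (e u).1 = (u : G ⧸ Subgroup.zpowers ζ) := rfl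
    obtain ⟨h, hh⟩ := QuotientGroup.mk_out_eq_mul (Subgroup.zpowers ζ) u
    rw [this, hh, hH]
  rw [Finset.sum_congr rfl fun u _ => he u]
  rw [e.sum_comp (fun p => f p.1.out)]
  rw [Fintype.sum_prod_type]
  simp only [Finset.sum_const, Finset.card_univ, Fintype.card_zpowers, nsmul_eq_mul]
  exact Finset.dvd_sum fun i _ => dvd_mul_right _ _

theorem add_mem_of_meets_subgroups {G : Type*} [AddCommGroup G] [Finite G]
    (h2 : ∀ x : G, x + x = 0) (m : ℕ) (hG : Nat.card G = 2 ^ m * 2 ^ m) (T : Set G)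
    (h0 : (0 : G) ∈ T) (hT : T.ncard = 2 ^ m)
    (hV : ∀ V : AddSubgroup G, (∀ x ∈ V, x ∈ T → x = 0) → Nat.card V ≤ 2 ^ m)
    {s t : G} (hs : s ∈ T) (ht : t ∈ T) : s + t ∈ T := by
  by_contra hw
  have hneg : ∀ x : G, -x = x := fun x => neg_eq_of_add_eq_zero_left (h2 x)
  let P : AddSubgroup G → Prop := fun V => s + t ∈ V ∧ ∀ x ∈ V, x ∈ T → x = 0
  have hmem : ∀ w x : G, x ∈ AddSubgroup.zmultiples w → x = 0 ∨ x = w := by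
    intro w x hx
    obtain ⟨k, rfl⟩ := AddSubgroup.mem_zmultiples_iff.1 hx
    obtain ⟨j, rfl | rfl⟩ := Int.even_or_odd' k
    · left; rw [mul_comm, mul_smul, two_zsmul, h2, smul_zero]
    · right; rw [add_smul, mul_comm, mul_smul, two_zsmul, h2, smul_zero, one_smul, zero_add]
  have hP : P (AddSubgroup.zmultiples (s + t)) := by
    refine ⟨AddSubgroup.mem_zmultiples _, fun x hx hxT => ?_⟩
    rcases hmem _ _ hx with h | h
    · exact h
    · exact absurd (h ▸ hxT) hw
  obtain ⟨V, -, hVmax⟩ := (Set.toFinite {V | P V}).exists_le_maximal hP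
  obtain ⟨⟨hwV, hVT⟩, hmax⟩ := hVmax
  let φ : T → G ⧸ V := fun x => (x : G)
  have hsurj : Function.Surjective φ := by
    intro q
    obtain ⟨x, rfl⟩ := QuotientAddGroup.mk_surjective q
    by_cases hx : x ∈ V
    · exact ⟨⟨0, h0⟩, by
        simp only [φ]; rw [QuotientAddGroup.eq]; simpa using hx⟩
    · by_contra hne
      refine hx (hmax (y := V ⊔ AddSubgroup.zmultiples x) ⟨le_sup_left (a := V) hwV, ?_⟩
        le_sup_left (le_sup_right (a := V) (AddSubgroup.mem_zmultiples x)))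
      intro z hz hzT
      obtain ⟨v, hv, y, hy, rfl⟩ := AddSubgroup.mem_sup.1 hz
      rcases hmem _ _ hy with rfl | rfl
      · rw [add_zero] at hzT ⊢
        exact hVT _ hv hzT
      · refine absurd ⟨⟨v + y, hzT⟩, ?_⟩ hne
        simp only [φ]
        rw [QuotientAddGroup.eq, hneg, add_assoc, h2, add_zero]
        exact hv
  have hcard : Nat.card T ≤ Nat.card (G ⧸ V) := by
    have h1 := AddSubgroup.card_eq_card_quotient_mul_card_addSubgroup V
    have h3 := hV V hVT
    rw [hG] at h1
    have h4 : Nat.card T = 2 ^ m := hT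
    rw [h4]
    by_contra! hlt
    have : Nat.card (G ⧸ V) * Nat.card V < 2 ^ m * 2 ^ m :=
      Nat.mul_lt_mul_of_lt_of_le hlt h3 (by positivity)
    omega
  have hinj := (hsurj.bijective_of_nat_card_le hcard).1
  have hst : (⟨s, hs⟩ : T) = ⟨t, ht⟩ := by
    apply hinj
    simp only [φ]
    rw [QuotientAddGroup.eq, hneg]
    exact hwV
  rw [Subtype.mk.injEq] at hst
  subst hst
  rw [h2] at hw
  exact hw h0

theorem digits_two_sum_eq_two {d : ℕ} (h : (Nat.digits 2 d).sum = 2) :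
    ∃ a b : ℕ, a ≠ b ∧ d = 2 ^ a + 2 ^ b := by
  have h1 : ∀ d : ℕ, (Nat.digits 2 d).sum = 1 → ∃ a, d = 2 ^ a := by
    intro d
    induction d using Nat.strong_induction_on with
    | _ d ih =>
      intro h
      rcases Nat.eq_zero_or_pos d with rfl | hd
      · simp at h
      rw [Nat.digits_def' one_lt_two hd, List.sum_cons] at h
      rcases Nat.mod_two_eq_zero_or_one d with h0 | h0
      · obtain ⟨a, ha⟩ := ih (d / 2) (by omega) (by omega)
        exact ⟨a + 1, by rw [pow_succ]; omega⟩
      · have hz : (Nat.digits 2 (d / 2)).sum = 0 := by omega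
        have hz' : d / 2 = 0 := by
          by_contra hne
          have := Nat.getLast_digit_ne_zero 2 hne
          have hmem := List.getLast_mem (Nat.digits_ne_nil_iff_ne_zero (b := 2).2 hne)
          exact this ((List.sum_eq_zero_iff.1 hz) _ hmem)
        exact ⟨0, by simp; omega⟩
  induction d using Nat.strong_induction_on with
  | _ d ih =>
    rcases Nat.eq_zero_or_pos d with rfl | hd
    · simp at h
    rw [Nat.digits_def' one_lt_two hd, List.sum_cons] at h
    rcases Nat.mod_two_eq_zero_or_one d with h0 | h0
    · obtain ⟨a, b, hab, ha⟩ := ih (d / 2) (by omega) (by omega)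
      exact ⟨a + 1, b + 1, by omega, by rw [pow_succ, pow_succ]; omega⟩
    · obtain ⟨a, ha⟩ := h1 (d / 2) (by omega)
      exact ⟨0, a + 1, by omega, by rw [pow_succ]; omega⟩

theorem two_pow_add_two_pow_inj {i j k l : ℕ} (h : 2 ^ i + 2 ^ j = 2 ^ k + 2 ^ l) :
    (i = k ∧ j = l) ∨ (i = l ∧ j = k) := by
  have key : ∀ {i j k l : ℕ}, i ≤ j → k ≤ l → 2 ^ i + 2 ^ j = 2 ^ k + 2 ^ l → i = k ∧ j = l := by
    intro i j k l hij hkl h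
    have lt : ∀ {i j k l : ℕ}, i ≤ j → j < l → 2 ^ i + 2 ^ j < 2 ^ k + 2 ^ l := by
      intro i j k l hij hjl
      have h1 : 2 ^ i ≤ 2 ^ j := Nat.pow_le_pow_right two_pos hij
      have h2 : 2 ^ (j + 1) ≤ 2 ^ l := Nat.pow_le_pow_right two_pos hjl
      have h3 : 0 < 2 ^ k := by positivity
      rw [pow_succ] at h2
      omega
    rcases lt_trichotomy j l with hjl | rfl | hjl
    · exact absurd h (lt hij hjl).ne
    · exact ⟨Nat.pow_right_injective le_rfl (Nat.add_right_cancel h), rfl⟩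
    · exact absurd h (lt hkl hjl).ne'
  rcases le_total i j with h1 | h1 <;> rcases le_total k l with h2 | h2
  · exact Or.inl (key h1 h2 h)
  · exact Or.inr (key h1 h2 (by omega))
  · exact Or.inr (key h1 h2 (by omega)).symm
  · exact Or.inl (key h1 h2 (by omega)).symm

theorem two_pow_add_two_pow_modEq {m a b c d : ℕ} (hm : 0 < m)
    (h : 2 ^ a + 2 ^ b ≡ 2 ^ c + 2 ^ d [MOD 2 ^ m - 1]) :
    (a ≡ c [MOD m] ∧ b ≡ d [MOD m]) ∨ (a ≡ d [MOD m] ∧ b ≡ c [MOD m]) := by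
  have hone : 1 ≤ 2 ^ m := Nat.one_le_two_pow
  have hred : ∀ a : ℕ, 2 ^ (a % m) ≡ 2 ^ a [MOD 2 ^ m - 1] := by
    intro a
    conv_rhs => rw [← Nat.mod_add_div a m, pow_add, pow_mul]
    have : 2 ^ m ≡ 1 [MOD 2 ^ m - 1] := ((Nat.modEq_iff_dvd' hone).2 dvd_rfl).symm
    simpa using ((this.pow (a / m)).mul_left (2 ^ (a % m))).symm
  have hle : ∀ a : ℕ, 1 ≤ 2 ^ (a % m) ∧ 2 * 2 ^ (a % m) ≤ 2 ^ m := by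
    intro a
    refine ⟨Nat.one_le_two_pow, ?_⟩
    rw [mul_comm, ← pow_succ]
    exact Nat.pow_le_pow_right two_pos (Nat.mod_lt a hm)
  have h' : 2 ^ (a % m) + 2 ^ (b % m) ≡ 2 ^ (c % m) + 2 ^ (d % m) [MOD 2 ^ m - 1] :=
    ((hred a).add (hred b)).trans (h.trans ((hred c).add (hred d)).symm)
  have ha := hle a
  have hb := hle b
  have hc := hle c
  have hd := hle d
  refine two_pow_add_two_pow_inj (le_antisymm ?_ ?_) <;> by_contra! hlt
  · have := Nat.le_of_dvd (by omega) ((Nat.modEq_iff_dvd' hlt.le).1 h'.symm)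
    omega
  · have := Nat.le_of_dvd (by omega) ((Nat.modEq_iff_dvd' hlt.le).1 h')
    omega

section Character

variable {K : Type*} [Field K] [Algebra (ZMod 2) K]

/-- The additive character `x ↦ (−1)^{Tr x}` of a finite field of characteristic two. -/
noncomputable def traceSign (x : K) : ℤ :=
  if Algebra.trace (ZMod 2) K x = 0 then 1 else -1

theorem traceSign_add (x y : K) : traceSign (x + y) = traceSign x * traceSign y := by
  have h : ∀ z : ZMod 2, z = 0 ∨ z = 1 := by decide
  have h11 : (1 : ZMod 2) + 1 = 0 := by decide
  unfold traceSign
  rw [map_add]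
  rcases h (Algebra.trace (ZMod 2) K x) with hx | hx <;>
    rcases h (Algebra.trace (ZMod 2) K y) with hy | hy <;> simp [hx, hy, h11]

theorem add_self_eq_zero_of_algebra (x : K) : x + x = 0 := by
  have : CharP K 2 := charP_of_injective_algebraMap (algebraMap (ZMod 2) K).injective 2
  exact CharTwo.add_self_eq_zero x

theorem add_eq_zero_iff_eq_of_algebra (x y : K) : x + y = 0 ↔ x = y := by
  rw [add_eq_zero_iff_eq_neg, neg_eq_of_add_eq_zero_left (add_self_eq_zero_of_algebra y)]

variable [Fintype K]

theorem walsh_eq_sum_traceSign (F : K → K) (a ω : K) :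
    walsh F a ω = ∑ v, traceSign (a * F v + ω * v) := by
  simp [walsh, traceSign]

theorem walsh_zero_right (F : K → K) (a : K) :
    walsh F a 0 = ∑ v, traceSign (a * F v) := by
  simp [walsh_eq_sum_traceSign]

theorem trace_pow_two_pow (k : ℕ) (x : K) :
    Algebra.trace (ZMod 2) K (x ^ 2 ^ k) = Algebra.trace (ZMod 2) K x := by
  induction k with
  | zero => simp
  | succ k ih =>
    rw [pow_succ, pow_mul, ← ih]
    have := Algebra.trace_eq_of_algEquiv
      (FiniteField.frobeniusAlgEquivOfAlgebraic (ZMod 2) K) (x ^ 2 ^ k)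
    simpa using this

open Classical in
theorem sum_walsh_addSubgroup (F : K → K) (V : AddSubgroup K) :
    ∑ a : K with a ∈ V, walsh F a 0 =
      Nat.card V * #{v : K | ∀ a ∈ V, Algebra.trace (ZMod 2) K (a * F v) = 0} := by
  have hcardV : (Nat.card V : ℤ) = ∑ a : K with a ∈ V, 1 := by
    rw [Finset.sum_const, nsmul_eq_mul, mul_one, Nat.card_eq_fintype_card, Fintype.card_subtype]
  have hsum : ∀ y : K, ∑ a : K with a ∈ V, traceSign (a * y) =
      if ∀ a ∈ V, Algebra.trace (ZMod 2) K (a * y) = 0 then (Nat.card V : ℤ) else 0 := by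
    intro y
    split_ifs with h
    · rw [hcardV]
      refine Finset.sum_congr rfl fun a ha => ?_
      rw [traceSign, if_pos (h a (Finset.mem_filter.1 ha).2)]
    · push Not at h
      obtain ⟨b, hb, hby⟩ := h
      have hshift : ∑ a : K with a ∈ V, traceSign (a * y) =
          ∑ a : K with a ∈ V, traceSign ((a + b) * y) := by
        symm
        refine Finset.sum_bij (fun a _ => a + b) ?_ ?_ ?_ ?_
        · intro a ha
          simp only [Finset.mem_filter, Finset.mem_univ, true_and] at ha ⊢
          exact V.add_mem ha hb
        · intro a _ a' _ h
          exact add_right_cancel h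
        · intro a ha
          simp only [Finset.mem_filter, Finset.mem_univ, true_and] at ha
          exact ⟨a - b, by simpa using V.sub_mem ha hb, by ring⟩
        · intros; rfl
      have hneg : traceSign (b * y) = -1 := by rw [traceSign, if_neg hby]
      simp_rw [add_mul, traceSign_add, hneg, mul_neg_one, Finset.sum_neg_distrib] at hshift
      omega
  simp_rw [walsh_zero_right]
  rw [Finset.sum_comm]
  simp_rw [hsum]
  rw [← Finset.sum_filter, Finset.sum_const, nsmul_eq_mul, mul_comm]

theorem walsh_zero_zero (F : K → K) : walsh F 0 0 = Fintype.card K := by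
  simp [walsh]

theorem not_isBent_zero {m : ℕ} (hm : 0 < m) (hcard : Fintype.card K = 2 ^ (2 * m)) (F : K → K) :
    ¬ IsBent m F 0 := by
  intro h
  have h1 := h 0
  rw [walsh_zero_zero, hcard] at h1
  have hpos : (0 : ℤ) < 2 ^ m := by positivity
  have hlt : (2 : ℤ) ^ m < 2 ^ (2 * m) := pow_lt_pow_right₀ (by norm_num) (by omega)
  push_cast at h1
  omega

/-- Nyberg's bound: a space of components that are bent away from zero has dimension at most
`m`. -/
theorem card_le_of_forall_isBent {m : ℕ} (hm : 0 < m) (hcard : Fintype.card K = 2 ^ (2 * m))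
    (F : K → K) (V : AddSubgroup K) (hV : ∀ a ∈ V, ¬ IsBent m F a → a = 0) :
    Nat.card V ≤ 2 ^ m := by
  classical
  obtain ⟨k, -, hk⟩ := (Nat.dvd_prime_pow Nat.prime_two).1
    (show Nat.card V ∣ 2 ^ (2 * m) by
      rw [← hcard, ← Nat.card_eq_fintype_card]; exact V.card_addSubgroup_dvd_card)
  rw [hk]
  refine Nat.pow_le_pow_right two_pos ?_
  by_contra! hmk
  have hsum := sum_walsh_addSubgroup F V
  have hmod : ∀ a ∈ ({a : K | a ∈ V} : Finset K).erase 0,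
      walsh F a 0 ≡ 2 ^ m [ZMOD 2 ^ (m + 1)] := by
    intro a ha
    simp only [Finset.mem_erase, Finset.mem_filter, Finset.mem_univ, true_and] at ha
    rcases (by_contra fun h => ha.1 (hV a ha.2 h) : IsBent m F a) 0 with h | h
    · rw [h]
    · rw [h]
      exact Int.modEq_iff_dvd.2 ⟨1, by ring⟩
  have h0 : (0 : K) ∈ ({a : K | a ∈ V} : Finset K) := by simp
  have hc : #(({a : K | a ∈ V} : Finset K).erase 0) = 2 ^ k - 1 := by
    rw [Finset.card_erase_of_mem h0, ← hk, Nat.card_eq_fintype_card, Fintype.card_subtype]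
  rw [← Finset.add_sum_erase _ _ h0, walsh_zero_zero, hcard, hk] at hsum
  have hmod' : ∑ a ∈ ({a : K | a ∈ V} : Finset K).erase 0, walsh F a 0 ≡
      ∑ a ∈ ({a : K | a ∈ V} : Finset K).erase 0, 2 ^ m [ZMOD 2 ^ (m + 1)] :=
    Int.ModEq.sum hmod
  rw [Finset.sum_const, hc, nsmul_eq_mul, Nat.cast_sub Nat.one_le_two_pow] at hmod'
  push_cast at hsum hmod'
  have hdk : (2 : ℤ) ^ (m + 1) ∣ 2 ^ k := pow_dvd_pow 2 hmk
  have hd2 : (2 : ℤ) ^ (m + 1) ∣ 2 ^ (2 * m) := pow_dvd_pow 2 (by omega)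
  have hdS : (2 : ℤ) ^ (m + 1) ∣ ∑ a ∈ ({a : K | a ∈ V} : Finset K).erase 0, walsh F a 0 := by
    rw [← dvd_add_right hd2, hsum]
    exact hdk.mul_right _
  have hd3 := hmod'.dvd_iff.1 hdS
  rw [sub_mul, one_mul] at hd3
  have hd4 := (dvd_sub_right (hdk.mul_right _)).1 hd3
  rw [pow_succ] at hd4
  have := Int.le_of_dvd (by positivity) hd4
  have hpos : (0 : ℤ) < 2 ^ m := by positivity
  omega

theorem isBent_mul {m : ℕ} {F : K → K} {x ζ a : K} (hx : x ≠ 0)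
    (hF : ∀ v, F (x * v) = ζ * F v) : IsBent m F (a * ζ) ↔ IsBent m F a := by
  have key : ∀ ω, walsh F (a * ζ) (ω * x) = walsh F a ω := by
    intro ω
    rw [walsh_eq_sum_traceSign, walsh_eq_sum_traceSign,
      ← Equiv.sum_comp (Equiv.mulLeft₀ x hx) (fun v => traceSign (a * F v + ω * v))]
    refine Finset.sum_congr rfl fun v _ => ?_
    rw [show Equiv.mulLeft₀ x hx v = x * v from rfl, hF]
    ring_nf
  constructor
  · intro h ω
    rw [← key]
    exact h _
  · intro h ω
    have := key (ω * x⁻¹)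
    rw [inv_mul_cancel_right₀ hx] at this
    rw [this]
    exact h _

end Character

section Binomial

variable {K : Type*} [Field K]

theorem units_pow_eq_pow_iff (u : Kˣ) (k l : ℕ) : (u : K) ^ k = (u : K) ^ l ↔ u ^ k = u ^ l := by
  rw [← Units.val_pow_eq_pow_val, ← Units.val_pow_eq_pow_val, Units.val_inj]

variable [Fintype K]

theorem sum_eq_zero_add_sum_units [DecidableEq K] (f : K → ℤ) :
    ∑ v, f v = f 0 + ∑ u : Kˣ, f u := by
  rw [Fintype.sum_eq_add_sum_subtype_ne f 0, ← (unitsEquivNeZero (G₀ := K)).sum_comp]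
  rfl

theorem exists_units_orderOf_eq {g : ℕ} (hg : g ∣ Fintype.card K - 1) :
    ∃ ζ : Kˣ, orderOf ζ = g := by
  classical
  obtain ⟨w, hw⟩ := IsCyclic.exists_ofOrder_eq_natCard (α := Kˣ)
  rw [Nat.card_eq_fintype_card, Fintype.card_units] at hw
  have hpos : 0 < Fintype.card K - 1 := by
    have := Fintype.one_lt_card (α := K)
    omega
  obtain ⟨k, hk⟩ := hg
  rw [hk] at hw hpos
  have hk0 : k ≠ 0 := by rintro rfl; simp at hpos
  refine ⟨w ^ k, ?_⟩
  rw [orderOf_pow_of_dvd hk0 (by rw [hw]; exact dvd_mul_left _ _), hw,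
    Nat.mul_div_cancel _ (Nat.pos_of_ne_zero hk0)]

theorem pow_two_pow_add_mul {m : ℕ} (hcard : Fintype.card K = 2 ^ (2 * m)) (k j : ℕ) (x : K) :
    x ^ 2 ^ (k + 2 * m * j) = x ^ 2 ^ k := by
  rw [pow_add, pow_mul x, pow_mul 2, ← hcard, FiniteField.pow_card_pow]

variable [Algebra (ZMod 2) K]

theorem forall_trace_mul_eq_zero_iff (y : K) :
    (∀ a : K, Algebra.trace (ZMod 2) K (a * y) = 0) ↔ y = 0 := by
  refine ⟨fun h => (traceForm_nondegenerate (ZMod 2) K).1 y fun a => ?_, ?_⟩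
  · rw [Algebra.traceForm_apply, mul_comm]
    exact h a
  · rintro rfl a
    simp

/-- A function invariant under the `g`-th roots of unity has components with
`W_{F_a}(0) ≡ 1 (mod g)`. -/
theorem dvd_walsh_zero_sub_one {g : ℕ} (hg : g ∣ Fintype.card K - 1) {F : K → K} (hF0 : F 0 = 0)
    (hF : ∀ ζ : Kˣ, ζ ^ g = 1 → ∀ v : K, F (v * ζ) = F v) (a : K) :
    (g : ℤ) ∣ walsh F a 0 - 1 := by
  classical
  obtain ⟨ζ, hζ⟩ := exists_units_orderOf_eq hg
  rw [walsh_zero_right, sum_eq_zero_add_sum_units]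
  have h1 : traceSign (a * F 0) = 1 := by simp [traceSign, hF0]
  rw [h1, add_sub_cancel_left, ← hζ]
  refine orderOf_dvd_sum_of_invariant ζ (fun u : Kˣ => traceSign (a * F u)) fun u => ?_
  simp only [Units.val_mul]
  rw [hF ζ (by rw [← hζ, pow_orderOf_eq_one])]

/-- If exactly `2^m` components are not bent, then the indices of these form a group. -/
def nonbentSubgroup {m : ℕ} (hm : 0 < m) (hcard : Fintype.card K = 2 ^ (2 * m)) (F : K → K)
    (hSF : Set.ncard {a : K | ¬ IsBent m F a} = 2 ^ m) : AddSubgroup K where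
  carrier := {a | ¬ IsBent m F a}
  zero_mem' := not_isBent_zero hm hcard F
  add_mem' := add_mem_of_meets_subgroups add_self_eq_zero_of_algebra m
    (by rw [Nat.card_eq_fintype_card, hcard, ← pow_add, two_mul]) _
    (not_isBent_zero hm hcard F) hSF (card_le_of_forall_isBent hm hcard F)
  neg_mem' := by
    intro x hx
    rwa [neg_eq_of_add_eq_zero_left (add_self_eq_zero_of_algebra x)]

open Classical in
/-- If `W_{F_a}(0)` equals `ε·2^m` for all bent components and the non-bent ones form a group of
order `2^m`, then the fibre sizes over zero and over the dual of that group are related. -/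
theorem card_fibre_of_walsh_eq {m : ℕ} (hcard : Fintype.card K = 2 ^ (2 * m)) {F : K → K}
    {S : AddSubgroup K} (hS : Nat.card S = 2 ^ m) {ε : ℤ}
    (hε : ∀ a ∉ S, walsh F a 0 = ε * 2 ^ m) :
    (2 : ℤ) ^ m * #{v : K | F v = 0} =
      #{v : K | ∀ a ∈ S, Algebra.trace (ZMod 2) K (a * F v) = 0} + ε * (2 ^ m * (2 ^ m - 1)) := by
  have hSsum := sum_walsh_addSubgroup F S
  have htop := sum_walsh_addSubgroup F (⊤ : AddSubgroup K)
  rw [AddSubgroup.card_top, Nat.card_eq_fintype_card, hcard] at htop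
  simp only [AddSubgroup.mem_top, true_imp_iff, forall_trace_mul_eq_zero_iff,
    Finset.filter_true] at htop
  have hcardS : #{a : K | a ∈ S} = 2 ^ m := by
    rw [← hS, Nat.card_eq_fintype_card, Fintype.card_subtype]
  have hcompl : (#{a : K | a ∉ S} : ℤ) = 2 ^ (2 * m) - 2 ^ m := by
    have := Finset.card_filter_add_card_filter_not (s := (Finset.univ : Finset K)) (· ∈ S)
    rw [hcardS, Finset.card_univ, hcard] at this
    have h' : ((2 ^ m + #{a : K | a ∉ S} : ℕ) : ℤ) = (2 ^ (2 * m) : ℕ) := congrArg _ this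
    push_cast at h'
    linarith
  have hnot : ∑ a : K with a ∉ S, walsh F a 0 = (2 ^ (2 * m) - 2 ^ m) * (ε * 2 ^ m) := by
    rw [Finset.sum_congr rfl fun a ha => hε a (Finset.mem_filter.1 ha).2, Finset.sum_const,
      nsmul_eq_mul, hcompl]
  rw [← Finset.sum_filter_add_sum_filter_not _ (· ∈ S), hSsum, hnot, hS] at htop
  push_cast at htop
  have hpos : (2 : ℤ) ^ m ≠ 0 := by positivity
  apply mul_left_cancel₀ hpos
  rw [two_mul, pow_add] at htop
  linear_combination -htop

open Classical in
theorem binomial_structure {m : ℕ} (hm : 0 < m) (hcard : Fintype.card K = 2 ^ (2 * m))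
    {d₁ d₂ : ℕ} (hd₁ : d₁ ≠ 0) (hd₂ : d₂ ≠ 0)
    (hgcd : 1 < Nat.gcd d₁ (Nat.gcd d₂ (2 ^ (2 * m) - 1)))
    {F : K → K} (hF : ∀ x, F x = x ^ d₁ + x ^ d₂)
    (hSF : Set.ncard {a : K | ¬ IsBent m F a} = 2 ^ m) :
    d₁ ≡ d₂ [MOD 2 ^ m - 1] ∧ (∀ v, F v = 0 ↔ v ^ 2 ^ m = v) ∧ #{v : K | F v = 0} = 2 ^ m ∧
      #{v : K | ∀ a, ¬ IsBent m F a → Algebra.trace (ZMod 2) K (a * F v) = 0} = 2 ^ m := by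
  set g := Nat.gcd d₁ (Nat.gcd d₂ (2 ^ (2 * m) - 1)) with hgdef
  have hg1 : g ∣ d₁ := Nat.gcd_dvd_left _ _
  have hg2 : g ∣ d₂ := (Nat.gcd_dvd_right _ _).trans (Nat.gcd_dvd_left _ _)
  have hgN : g ∣ 2 ^ (2 * m) - 1 := (Nat.gcd_dvd_right _ _).trans (Nat.gcd_dvd_right _ _)
  have hq1 : 1 < 2 ^ m := Nat.one_lt_two_pow hm.ne'
  have hNfac : 2 ^ (2 * m) - 1 = (2 ^ m - 1) * (2 ^ m + 1) := by
    rw [two_mul, pow_add, mul_comm (2 ^ m - 1), ← Nat.mul_self_sub_mul_self_eq]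
  have hqodd : ¬ 2 ∣ 2 ^ (2 * m) - 1 := by
    have h1 : 2 ∣ 2 ^ (2 * m) := dvd_pow_self 2 (by omega)
    have h2 : 1 ≤ 2 ^ (2 * m) := Nat.one_le_two_pow
    omega
  have hF0 : F 0 = 0 := by simp [hF, hd₁, hd₂]
  have hFzero : ∀ v, F v = 0 ↔ v ^ d₁ = v ^ d₂ := fun v => by
    rw [hF, add_eq_zero_iff_eq_of_algebra]
  set S := nonbentSubgroup hm hcard F hSF
  have hmemS : ∀ a, a ∈ S ↔ ¬ IsBent m F a := fun a => Iff.rfl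
  have hS : Nat.card S = 2 ^ m := hSF
  set Z := #{v : K | F v = 0} with hZ
  have hZ'def : #{v : K | ∀ a, ¬ IsBent m F a → Algebra.trace (ZMod 2) K (a * F v) = 0} =
      #{v : K | ∀ a ∈ S, Algebra.trace (ZMod 2) K (a * F v) = 0} := by
    simp only [hmemS]
  rw [hZ'def]
  set Z' := #{v : K | ∀ a ∈ S, Algebra.trace (ZMod 2) K (a * F v) = 0} with hZ'
  have hZ2 : 2 ≤ Z := by
    have h01 : ({0, 1} : Finset K) ⊆ ({v : K | F v = 0} : Finset K) := by
      intro v hv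
      simp only [Finset.mem_insert, Finset.mem_singleton] at hv
      rcases hv with rfl | rfl <;> simp [hFzero, hd₁, hd₂]
    have := Finset.card_le_card h01
    rwa [Finset.card_pair zero_ne_one] at this
  have hZle : Z ≤ Z' := by
    refine Finset.card_le_card fun v hv => ?_
    simp only [Finset.mem_filter, Finset.mem_univ, true_and] at hv ⊢
    simp [hv]
  have hZ'le : Z' ≤ 2 ^ (2 * m) := hcard ▸ Finset.card_le_univ _
  have hdvd := dvd_walsh_zero_sub_one (by rw [hcard]; exact hgN) hF0 (g := g) (by
    intro ζ hζ v
    have hpow : ∀ d, g ∣ d → ((ζ : K)) ^ d = 1 := by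
      rintro _ ⟨k, rfl⟩
      rw [pow_mul, ← Units.val_pow_eq_pow_val, hζ, Units.val_one, one_pow]
    rw [hF, hF, mul_pow, mul_pow, hpow _ hg1, hpow _ hg2, mul_one, mul_one])
  have hbent : ∀ a ∉ S, walsh F a 0 = 2 ^ m ∨ walsh F a 0 = -2 ^ m := fun a ha =>
    (not_not.1 ((hmemS a).not.1 ha)) 0
  have hgq : (g : ℤ) ∣ 2 ^ m - 1 := by
    by_contra hnd
    have hrel := card_fibre_of_walsh_eq hcard hS (ε := -1) fun a ha => by
      rcases hbent a ha with h | h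
      · exact absurd (h ▸ hdvd a) hnd
      · rw [h]; ring
    rw [← hZ, ← hZ'] at hrel
    have h1 : (Z' : ℤ) ≤ 2 ^ m * 2 ^ m := by
      rw [← pow_add, ← two_mul]; exact_mod_cast hZ'le
    have h2 : (2 : ℤ) ≤ Z := by exact_mod_cast hZ2
    have h3 : (0 : ℤ) < 2 ^ m := by positivity
    nlinarith
  have hrel := card_fibre_of_walsh_eq hcard hS (ε := 1) fun a ha => by
    rcases hbent a ha with h | h
    · rw [h]; ring
    · exfalso
      have h1 := hdvd a
      rw [h] at h1
      have h2 : (g : ℤ) ∣ 2 := by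
        have := dvd_add h1 hgq
        rw [← dvd_neg]
        convert this using 1
        ring
      have h3 : g ∣ 2 := by exact_mod_cast h2
      rcases (Nat.dvd_prime Nat.prime_two).1 h3 with h | h
      · omega
      · exact hqodd (h ▸ hgN)
  rw [← hZ, ← hZ', one_mul] at hrel
  have hgq' : g ∣ 2 ^ m - 1 := by
    have : ((2 ^ m - 1 : ℕ) : ℤ) = 2 ^ m - 1 := by push_cast [hq1.le]; rfl
    rw [← this] at hgq
    exact_mod_cast hgq
  have hZge : 2 ^ m ≤ Z := by
    by_contra! hlt
    have h1 : (Z : ℤ) ≤ 2 ^ m - 1 := by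
      have : (Z : ℤ) < 2 ^ m := by exact_mod_cast hlt
      omega
    have h2 : (0 : ℤ) < Z' := by exact_mod_cast (by omega : 0 < Z')
    have h3 : (0 : ℤ) < 2 ^ m := by positivity
    nlinarith
  have hTU : ∀ u : Kˣ, F u = 0 → u ^ (2 ^ m - 1) = 1 := by
    intro u hu
    have hu' := (hFzero u).1 hu
    have hud : u ^ d₁ = u ^ d₂ := (units_pow_eq_pow_iff u d₁ d₂).1 hu'
    have hinv : ∀ a : K, a * (u : K) ^ d₁ ∈ S ↔ a ∈ S := fun a => by
      rw [hmemS, hmemS, isBent_mul u.ne_zero]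
      intro v
      rw [hF, hF, mul_pow, mul_pow, ← hu', mul_add]
    have hord := orderOf_dvd_sum_of_invariant (u ^ d₁)
      (fun w : Kˣ => if (w : K) ∈ S then 1 else 0) fun w => by
        simp only [Units.val_mul, Units.val_pow_eq_pow_val, hinv]
    have hcount := sum_eq_zero_add_sum_units (fun v : K => if v ∈ S then 1 else 0)
    rw [Finset.sum_boole, if_pos S.zero_mem, ← Fintype.card_subtype,
      ← Nat.card_eq_fintype_card, hS] at hcount
    have hord' : orderOf (u ^ d₁) ∣ 2 ^ m - 1 := by
      rw [← Int.natCast_dvd_natCast]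
      convert hord using 1
      push_cast [hq1.le] at hcount ⊢
      omega
    have h1 : (u ^ (2 ^ m - 1)) ^ d₁ = 1 := by
      rw [← pow_mul, mul_comm, pow_mul]
      exact orderOf_dvd_iff_pow_eq_one.1 hord'
    have h2 : (u ^ (2 ^ m - 1)) ^ d₂ = 1 := by
      rw [← h1, ← pow_mul, ← pow_mul, mul_comm, pow_mul, ← hud, ← pow_mul, mul_comm]
    have hN1 : u ^ (2 ^ (2 * m) - 1) = 1 := by
      rw [← hcard, ← Fintype.card_units, pow_card_eq_one]
    have h3 : (u ^ (2 ^ m - 1)) ^ (2 ^ (2 * m) - 1) = 1 := by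
      rw [← pow_mul, mul_comm, pow_mul, hN1, one_pow]
    have h4 : (u ^ (2 ^ m - 1)) ^ g = 1 := by
      rw [hgdef, pow_gcd_eq_one, pow_gcd_eq_one]
      exact ⟨h1, h2, h3⟩
    have h5 : (u ^ (2 ^ m - 1)) ^ (2 ^ m - 1) = 1 := by
      obtain ⟨k, hk⟩ := hgq'
      conv_lhs => rw [hk, pow_mul _ g k]
      rw [← hk, h4, one_pow]
    have h6 : (u ^ (2 ^ m - 1)) ^ (2 ^ m + 1) = 1 := by
      rw [← pow_mul, ← hNfac, hN1]
    have h7 : (u ^ (2 ^ m - 1)) ^ 2 = 1 := by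
      have : 2 ^ m + 1 = (2 ^ m - 1) + 2 := by omega
      rwa [this, pow_add, h5, one_mul] at h6
    have hcop : Nat.Coprime 2 (2 ^ (2 * m) - 1) :=
      (Nat.Prime.coprime_iff_not_dvd Nat.prime_two).2 hqodd
    have h8 := pow_gcd_eq_one.2 ⟨h7, h3⟩
    rwa [hcop.gcd_eq_one, pow_one] at h8
  have hcountT := sum_eq_zero_add_sum_units (fun v : K => if F v = 0 then 1 else 0)
  rw [Finset.sum_boole, if_pos hF0, ← hZ, Finset.sum_boole] at hcountT
  have hcountT' : Z = 1 + #{u : Kˣ | F u = 0} := by exact_mod_cast hcountT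
  have hU := IsCyclic.card_pow_eq_one_le (α := Kˣ) (n := 2 ^ m - 1) (by omega)
  have hsub : ({u : Kˣ | F u = 0} : Finset Kˣ) ⊆
      ({u : Kˣ | u ^ (2 ^ m - 1) = 1} : Finset Kˣ) := by
    intro u hu
    simp only [Finset.mem_filter, Finset.mem_univ, true_and] at hu ⊢
    exact hTU u hu
  have hEq := Finset.eq_of_subset_of_card_le hsub (by omega)
  have hiff : ∀ u : Kˣ, F u = 0 ↔ u ^ (2 ^ m - 1) = 1 := fun u => by
    simpa using Finset.ext_iff.1 hEq u
  have hZq : Z = 2 ^ m := by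
    have := Finset.card_le_card hsub
    omega
  refine ⟨?_, ?_, hZq, ?_⟩
  · obtain ⟨u, hu⟩ := exists_units_orderOf_eq (K := K) (g := 2 ^ m - 1)
      (by rw [hcard, hNfac]; exact dvd_mul_right _ _)
    have h1 := (hFzero u).1 ((hiff u).2 (by rw [← hu, pow_orderOf_eq_one]))
    rw [units_pow_eq_pow_iff, pow_eq_pow_iff_modEq, hu] at h1
    exact h1
  · intro v
    rcases eq_or_ne v 0 with rfl | hv
    · simp [hF0]
    · lift v to Kˣ using hv.isUnit
      rw [hiff]
      have : 2 ^ m = 2 ^ m - 1 + 1 := by omega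
      conv_rhs => rw [this, pow_succ]
      rw [mul_eq_right₀ v.ne_zero, ← Units.val_pow_eq_pow_val, Units.val_eq_one]
  · rw [hZq] at hrel
    push_cast at hrel
    have : (Z' : ℤ) = 2 ^ m := by linarith
    exact_mod_cast this

theorem trace_eq_zero_of_conjugate_sum {m : ℕ} (hm : 0 < m)
    (hcard : Fintype.card K = 2 ^ (2 * m)) {F : K → K} {f : K → K}
    (hF : ∀ x, F x = f x + f x ^ 2 ^ m)
    (hSF : Set.ncard {a : K | ¬ IsBent m F a} = 2 ^ m)
    (hfix : Set.ncard {v : K | v ^ 2 ^ m = v} = 2 ^ m) :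
    ∀ v a, ¬ IsBent m F a → Algebra.trace (ZMod 2) K (a * F v) = 0 := by
  have htr : ∀ a : K, a ^ 2 ^ m = a → ∀ v, Algebra.trace (ZMod 2) K (a * F v) = 0 := by
    intro a ha v
    have h1 : a * F v = a * f v + (a * f v) ^ 2 ^ m := by rw [hF, mul_pow, ha, mul_add]
    rw [h1, map_add, trace_pow_two_pow]
    exact CharTwo.add_self_eq_zero _
  have hsub : {v : K | v ^ 2 ^ m = v} ⊆ {a : K | ¬ IsBent m F a} := by
    intro a ha hb
    apply not_isBent_zero hm hcard F
    intro ω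
    have hω := hb ω
    simpa [walsh, htr a ha] using hω
  have heq := Set.eq_of_subset_of_ncard_le hsub (by rw [hSF, hfix])
  intro v a ha
  have : a ∈ {v : K | v ^ 2 ^ m = v} := heq ▸ ha
  exact htr a this v

end Binomial

theorem eq_or_eq_add_of_modEq {m b c : ℕ} (hb : b < 2 * m) (hc : c < 2 * m)
    (h : b ≡ c [MOD m]) : b = c ∨ b = c + m ∨ c = b + m := by
  have key : ∀ {b c : ℕ}, c < 2 * m → b ≤ c → b ≡ c [MOD m] → b = c ∨ c = b + m := by
    intro b c hc hle h
    obtain ⟨k, hk⟩ := (Nat.modEq_iff_dvd' hle).1 h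
    rcases k with _ | _ | k
    · left; simp at hk; omega
    · right; simp at hk; omega
    · exfalso
      have : m * (k + 1 + 1) = m * k + 2 * m := by ring
      have := Nat.zero_le (m * k)
      omega
  rcases le_total b c with hle | hle
  · rcases key hc hle h with h | h
    · exact Or.inl h
    · exact Or.inr (Or.inr h)
  · rcases key hb hle h.symm with h | h
    · exact Or.inl h.symm
    · exact Or.inr (Or.inl h)

section Equivalence

variable {K : Type*} [Field K] [Fintype K] [Algebra (ZMod 2) K]

theorem eaEquiv_of_shifted_exponent {m : ℕ} (hm : 0 < m) (hcard : Fintype.card K = 2 ^ (2 * m))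
    {a b : ℕ} (ha : a < 2 * m) (hb : b < m) (hab : a ≠ b) (hab' : a ≠ b + m) {F : K → K}
    (hF : ∀ x, F x = x ^ 2 ^ a * (x ^ 2 ^ b + x ^ 2 ^ (b + m))) :
    ∃ l : ℕ, 0 < l ∧ l < m ∧
      EAEquiv F (fun x : K => x ^ (1 + 2 ^ l) + x ^ (2 ^ l + 2 ^ m)) := by
  have hchar : CharP K 2 := charP_of_injective_algebraMap (algebraMap (ZMod 2) K).injective 2
  set l := (a + m - b) % m with hl
  have hlm : l < m := Nat.mod_lt _ hm
  have hl0 : 0 < l := by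
    by_contra! h0
    have h1 : b ≡ a + m [MOD m] := (Nat.modEq_iff_dvd' (by omega)).2
      (Nat.dvd_of_mod_eq_zero (by omega))
    have h2 : b ≡ a [MOD m] := by simpa [Nat.ModEq] using h1
    rcases eq_or_eq_add_of_modEq (by omega) ha h2 with h | h | h <;> omega
  have hdiv := Nat.mod_add_div (a + m - b) m
  obtain ⟨t, ht⟩ : ∃ t, b + (l + 2 * m - a) = m * t := by
    refine ⟨3 - (a + m - b) / m, ?_⟩
    have hk : (a + m - b) / m ≤ 3 := by
      rw [← Nat.lt_succ_iff, Nat.div_lt_iff_lt_mul hm]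
      omega
    rw [Nat.mul_sub]
    have : m * ((a + m - b) / m) ≤ m * 3 := Nat.mul_le_mul_left m hk
    omega
  have hper := pow_two_pow_add_mul (K := K) hcard
  have hsum : ∀ x : K, x ^ 2 ^ (m * t) + x ^ 2 ^ (m * t + m) = x + x ^ 2 ^ m := by
    intro x
    obtain ⟨s, rfl | rfl⟩ := Nat.even_or_odd' t
    · have h1 := hper 0 s x
      have h2 := hper m s x
      rw [show m * (2 * s) = 0 + 2 * m * s by ring, h1, show 0 + 2 * m * s + m = m + 2 * m * s by ring,
        h2]
      simp
    · have h1 := hper m s x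
      have h2 := hper 0 (s + 1) x
      rw [show m * (2 * s + 1) = m + 2 * m * s by ring, h1,
        show m + 2 * m * s + m = 0 + 2 * m * (s + 1) by ring, h2, add_comm]
      simp
  refine ⟨l, hl0, hlm, fun x => x ^ 2 ^ (l + 2 * m - a), id, fun _ => 0,
    ⟨((iterateFrobenius K 2 (l + 2 * m - a)).toAddMonoidHom).toZModLinearMap 2, 0, fun x => ?_⟩,
    ?_, ⟨LinearMap.id, 0, fun x => by simp⟩, Function.bijective_id, ⟨0, 0, fun x => by simp⟩,
    fun x => ?_⟩
  · simp [iterateFrobenius_def]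
  · exact bijective_iterateFrobenius K 2 (l + 2 * m - a)
  · simp only [id, add_zero]
    rw [hF, ← pow_mul, ← pow_mul, ← pow_mul, ← pow_add, ← pow_add, ← pow_add,
      show l + 2 * m - a + a = l + 2 * m * 1 by omega, hper,
      show l + 2 * m - a + b = m * t by omega,
      show l + 2 * m - a + (b + m) = m * t + m by omega, hsum]
    ring

theorem eaEquiv_of_common_exponent {m : ℕ} (hm : 0 < m) (hcard : Fintype.card K = 2 ^ (2 * m))
    {a b c : ℕ} (ha : a < 2 * m) (hb : b < 2 * m) (hc : c < 2 * m) (hab : a ≠ b) (hac : a ≠ c)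
    (hbc : b = c + m ∨ c = b + m) {F : K → K}
    (hF : ∀ x, F x = x ^ (2 ^ a + 2 ^ b) + x ^ (2 ^ a + 2 ^ c)) :
    ∃ l : ℕ, 0 < l ∧ l < m ∧
      EAEquiv F (fun x : K => x ^ (1 + 2 ^ l) + x ^ (2 ^ l + 2 ^ m)) := by
  rcases hbc with rfl | rfl
  · exact eaEquiv_of_shifted_exponent hm hcard ha (b := c) (by omega) hac hab
      fun x => by rw [hF, pow_add, pow_add]; ring
  · exact eaEquiv_of_shifted_exponent hm hcard ha (b := b) (by omega) hab hac
      fun x => by rw [hF, pow_add, pow_add]; ring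

end Equivalence

theorem exists_exponents_of_wt2_eq_two {n d : ℕ} (hd : d < 2 ^ n - 1)
    (hw : wt2 (2 ^ n - 1) (d : ℤ) = 2) :
    ∃ a b : ℕ, a ≠ b ∧ a < n ∧ b < n ∧ d = 2 ^ a + 2 ^ b := by
  rw [wt2, ← Int.natCast_mod, Int.toNat_natCast, Nat.mod_eq_of_lt hd] at hw
  obtain ⟨a, b, hab, rfl⟩ := digits_two_sum_eq_two hw
  have ha : 0 < 2 ^ a := by positivity
  have hb : 0 < 2 ^ b := by positivity
  exact ⟨a, b, hab, (Nat.pow_lt_pow_iff_right one_lt_two).1 (by omega),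
    (Nat.pow_lt_pow_iff_right one_lt_two).1 (by omega), rfl⟩

/-- Let `n = 2m`, `N = 2^n − 1`, `F(x) = x^{d₁} + x^{d₂}` with `wt₂(d₁) = wt₂(d₂) = 2` and
`gcd(d₁, d₂, N) > 1`.  If `ℓ(n) > m` and `#S_F = 2^m`, then `F` is EA-equivalent to
`x ↦ x^{1+2^l} + x^{2^l+2^m}` for some `0 < l < m`. -/
theorem stmt13 (m n : ℕ) (hm : 0 < m) (hn : n = 2 * m) (N : ℕ) (hN : N = 2 ^ n - 1)
    (K : Type*) [Field K] [Fintype K] [Algebra (ZMod 2) K]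
    (hcard : Fintype.card K = 2 ^ n)
    (d₁ d₂ : ℕ) (hd₁ : 1 ≤ d₁) (hd₁' : d₁ ≤ N - 1) (hd₂ : 1 ≤ d₂) (hd₂' : d₂ ≤ N - 1)
    (hw₁ : wt2 N (d₁ : ℤ) = 2) (hw₂ : wt2 N (d₂ : ℤ) = 2)
    (hgcd : 1 < Nat.gcd d₁ (Nat.gcd d₂ N))
    (F : K → K) (hF : ∀ x, F x = x ^ d₁ + x ^ d₂)
    (hell : ∀ γ : K, Subfield.closure {γ} = ⊤ →
      m < Module.finrank (ZMod 2) (frobSpan K γ))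
    (hSF : Set.ncard {a : K | ¬ IsBent m F a} = 2 ^ m) :
    ∃ l : ℕ, 0 < l ∧ l < m ∧
      EAEquiv F (fun x : K => x ^ (1 + 2 ^ l) + x ^ (2 ^ l + 2 ^ m)) := by
  classical
  subst hn hN
  have hN2 : 2 ≤ 2 ^ (2 * m) - 1 := by
    have : 2 ^ 2 ≤ 2 ^ (2 * m) := Nat.pow_le_pow_right two_pos (by omega)
    omega
  obtain ⟨a, b, hab, ha, hb, hdab⟩ := exists_exponents_of_wt2_eq_two (by omega) hw₁
  obtain ⟨c, d, hcd, hc, hd, hdcd⟩ := exists_exponents_of_wt2_eq_two (by omega) hw₂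
  obtain ⟨hmod, hfix, hZ, hZ'⟩ := binomial_structure hm hcard (by omega) (by omega) hgcd hF hSF
  have hlt : 2 ^ m < 2 ^ (2 * m) := Nat.pow_lt_pow_right one_lt_two (by omega)
  have hper := pow_two_pow_add_mul (K := K) hcard
  have hshift : ∀ {i j : ℕ}, (i = j + m ∨ j = i + m) → ∀ x : K, x ^ 2 ^ j = (x ^ 2 ^ i) ^ 2 ^ m := by
    rintro i j (rfl | rfl) x
    · rw [← pow_mul, ← pow_add, ← hper j 1]
      ring_nf
    · rw [← pow_mul, ← pow_add]
  have hne : d₁ ≠ d₂ := by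
    rintro rfl
    have huniv : ({v : K | F v = 0} : Finset K) = Finset.univ := by
      refine Finset.filter_true_of_mem fun v _ => ?_
      rw [hF, add_self_eq_zero_of_algebra]
    rw [huniv, Finset.card_univ, hcard] at hZ
    omega
  have main : ∀ c d : ℕ, c ≠ d → c < 2 * m → d < 2 * m → d₂ = 2 ^ c + 2 ^ d →
      a ≡ c [MOD m] → b ≡ d [MOD m] → ∃ l : ℕ, 0 < l ∧ l < m ∧
        EAEquiv F (fun x : K => x ^ (1 + 2 ^ l) + x ^ (2 ^ l + 2 ^ m)) := by
    intro c d hcd hc hd hdcd hac hbd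
    rcases eq_or_eq_add_of_modEq ha hc hac with rfl | hac' <;>
      rcases eq_or_eq_add_of_modEq hb hd hbd with rfl | hbd'
    · exact absurd (hdab.trans hdcd.symm) hne
    · exact eaEquiv_of_common_exponent hm hcard ha hb hd hab hcd hbd'
        fun x => by rw [hF, hdab, hdcd]
    · exact eaEquiv_of_common_exponent hm hcard hb ha hc hab.symm hcd.symm hac'
        fun x => by rw [hF, hdab, hdcd, add_comm (2 ^ a), add_comm (2 ^ c)]
    · exfalso
      have hconj := trace_eq_zero_of_conjugate_sum hm hcard (F := F) (f := fun x => x ^ d₁)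
        (fun x => by
          rw [hF, hdcd, pow_add x (2 ^ c), hshift hac', hshift hbd', ← mul_pow, ← pow_add, hdab])
        hSF (by
          conv_rhs => rw [← hZ, ← Set.ncard_coe_finset]
          simp [hfix])
      rw [Finset.filter_true_of_mem fun v _ => hconj v, Finset.card_univ, hcard] at hZ'
      omega
  rw [hdab, hdcd] at hmod
  rcases two_pow_add_two_pow_modEq hm hmod with ⟨hac, hbd⟩ | ⟨had, hbc⟩
  · exact main c d hcd hc hd hdcd hac hbd
  · exact main d c hcd.symm hd hc (by rw [hdcd, add_comm]) had hbc
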